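/- Let G = ([n], E) be a natural unit interval graph and let σ be a permutation of [n] with one-line notation σ_1σ_2…σ_n such that every descent of σ is a G-descent. Let Π(σ) be the ordered partition of [n] obtained by cutting the one-line notation of σ immediately after each right-to-left minimum. Then for every block B of Π(σ), the subgraph of G induced on B is connected. -/

import Mathlib

open Classical

/-- `G` is a natural unit interval graph: for every edge `{i,j}` with `i < j` and every
`i < k < j`, both `{i,k}` and `{k,j}` are edges. -/
def IsNaturalUnitIntervalGraph {n : ℕ} (G : SimpleGraph (Fin n)) : Prop :=
  ∀ i j k : Fin n, G.Adj i j → i < k → k < j → G.Adj i k ∧ G.Adj k j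

/-- Every descent of `σ` is a `G`-descent: whenever `σ_t > σ_{t+1}`,
`{σ_t, σ_{t+1}}` is an edge of `G`. -/
def AllDescentsGDescents {n : ℕ} (G : SimpleGraph (Fin n)) (σ : Equiv.Perm (Fin n)) : Prop :=
  ∀ (t : ℕ) (h : t + 1 < n), σ ⟨t + 1, h⟩ < σ ⟨t, Nat.lt_of_succ_lt h⟩ →
    G.Adj (σ ⟨t, Nat.lt_of_succ_lt h⟩) (σ ⟨t + 1, h⟩)
/-- Position `c` holds a right-to-left minimum of `σ`. -/
def RLminPos {n : ℕ} (σ : Equiv.Perm (Fin n)) (c : Fin n) : Prop :=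
  ∀ d : Fin n, c < d → σ c < σ d

/-- Values `i` and `j` lie in the same block of the ordered partition `Π(σ)` obtained by
cutting the one-line notation of `σ` immediately after every right-to-left minimum:
no position strictly between their positions (inclusive on the left) is a
right-to-left-minimum position. -/
def sameBlock {n : ℕ} (σ : Equiv.Perm (Fin n)) (i j : Fin n) : Prop :=
  ∀ c : Fin n, min (σ.symm i) (σ.symm j) ≤ c → c < max (σ.symm i) (σ.symm j) →
    ¬ RLminPos σ c

/-- The block of `Π(σ)` containing the value `i`. -/
noncomputable def blockOf {n : ℕ} (σ : Equiv.Perm (Fin n)) (i : Fin n) : Finset (Fin n) :=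
  Finset.univ.filter fun j => sameBlock σ i j

/-- If position `p` does not hold a right-to-left minimum, then `σ p` is adjacent to the first
smaller entry to its right, and no right-to-left minimum sits strictly before that entry. -/
theorem exists_adj_of_not_rlminPos {n : ℕ} {G : SimpleGraph (Fin n)}
    (hG : IsNaturalUnitIntervalGraph G) {σ : Equiv.Perm (Fin n)} (hσ : AllDescentsGDescents G σ)
    {p : Fin n} (hp : ¬ RLminPos σ p) :
    ∃ d, p < d ∧ G.Adj (σ p) (σ d) ∧ ∀ c, p ≤ c → c < d → ¬ RLminPos σ c := by
  have hex : ∃ m : ℕ, ∃ h : m < n, p.val < m ∧ σ ⟨m, h⟩ < σ p := by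
    simp only [RLminPos, not_forall, not_lt] at hp
    obtain ⟨d, hpd, hd⟩ := hp
    exact ⟨d, d.2, hpd, lt_of_le_of_ne hd fun h => hpd.ne' (σ.injective h)⟩
  obtain ⟨hm, hpm, hlt⟩ := Nat.find_spec hex
  have hmin : ∀ c : Fin n, p ≤ c → c.val < Nat.find hex → σ p ≤ σ c := by
    intro c hpc hc
    rcases hpc.eq_or_lt with rfl | hpc
    · exact le_rfl
    · by_contra h
      exact Nat.find_min hex hc ⟨c.2, hpc, not_le.mp h⟩
  generalize Nat.find hex = m at hm hpm hlt hmin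
  obtain ⟨t, rfl⟩ : ∃ t, m = t + 1 := ⟨m - 1, by omega⟩
  have ht : t < n := by omega
  have hle : σ p ≤ σ ⟨t, ht⟩ := hmin _ (Fin.le_def.mpr (by simp; omega)) (Nat.lt_succ_self t)
  have hadj := hσ t hm (hlt.trans_le hle)
  refine ⟨⟨t + 1, hm⟩, hpm, ?_, fun c hpc hc hR => ?_⟩
  · rcases hle.eq_or_lt with h | h
    · rwa [h]
    · exact (hG _ _ _ hadj.symm hlt h).1.symm
  · exact absurd (hR _ hc) (not_lt.mpr (hlt.le.trans (hmin c hpc hc)))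

/-- A block extends to the right across positions that hold no right-to-left minimum. -/
theorem sameBlock.extend {n : ℕ} {σ : Equiv.Perm (Fin n)} {i : Fin n} {p d : Fin n}
    (h : sameBlock σ i (σ p)) (hpd : ∀ c, p ≤ c → c < d → ¬ RLminPos σ c) (hlt : p < d) :
    sameBlock σ i (σ d) := by
  intro c hc₁ hc₂
  have hc := h c
  simp only [Equiv.symm_apply_apply, min_le_iff, lt_max_iff] at hc hc₁ hc₂
  by_cases hcp : p ≤ c
  · by_cases hcd : c < d
    · exact hpd c hcp hcd
    · exact hc (.inr hcp) (.inl (hc₂.resolve_right hcd))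
  · have hcp := not_le.mp hcp
    exact hc (.inl (hc₁.resolve_right (not_le.mpr (hcp.trans hlt)))) (.inr hcp)

/-- A block contains at most one right-to-left minimum. -/
theorem rlminPos_le_of_sameBlock {n : ℕ} {σ : Equiv.Perm (Fin n)} {i : Fin n} {p q : Fin n}
    (hp : sameBlock σ i (σ p)) (hq : sameBlock σ i (σ q)) (hR : RLminPos σ p) : q ≤ p := by
  by_contra! h
  have hp := hp p
  have hq := hq p
  simp only [Equiv.symm_apply_apply, min_le_iff, lt_max_iff, le_refl, lt_irrefl, or_true,
    or_false, forall_const] at hp hq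
  by_cases hi : p < σ.symm i
  · exact hp hi hR
  · exact hq (.inl (not_lt.mp hi)) (.inr h) hR

/-- Every entry of a block is joined, inside the block, to a right-to-left minimum. -/
theorem exists_reachable_rlminPos {n : ℕ} {G : SimpleGraph (Fin n)}
    (hG : IsNaturalUnitIntervalGraph G) {σ : Equiv.Perm (Fin n)} (hσ : AllDescentsGDescents G σ)
    (i p : Fin n) (hp : sameBlock σ i (σ p)) :
    ∃ q, ∃ hq : sameBlock σ i (σ q), RLminPos σ q ∧
      (G.induce {j : Fin n | sameBlock σ i j}).Reachable ⟨σ p, hp⟩ ⟨σ q, hq⟩ := by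
  induction p using WellFoundedGT.induction with
  | ind p ih =>
    by_cases hR : RLminPos σ p
    · exact ⟨p, hp, hR, .refl _⟩
    · obtain ⟨d, hpd, hadj, hd⟩ := exists_adj_of_not_rlminPos hG hσ hR
      obtain ⟨q, hq, hqR, hreach⟩ := ih d hpd (hp.extend hd hpd)
      refine ⟨q, hq, hqR, .trans (SimpleGraph.Adj.reachable ?_) hreach⟩
      exact hadj

/-- if every descent of `σ` is a `G`-descent for a natural unit interval
graph `G`, then every block of the partition `Π(σ)` of `σ` at its right-to-left minima
induces a connected subgraph of `G`. -/
theorem blocks_induce_connected {n : ℕ} (G : SimpleGraph (Fin n))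
    (hG : IsNaturalUnitIntervalGraph G)
    (σ : Equiv.Perm (Fin n)) (hσ : AllDescentsGDescents G σ) :
    ∀ i : Fin n, (G.induce {j : Fin n | sameBlock σ i j}).Connected := by
  intro i
  have : Nonempty {j : Fin n | sameBlock σ i j} :=
    ⟨⟨i, fun c hc₁ hc₂ => absurd hc₂ (by simpa using hc₁)⟩⟩
  refine ⟨?_⟩
  rintro ⟨u, hu⟩ ⟨v, hv⟩
  obtain ⟨p, rfl⟩ := σ.surjective u
  obtain ⟨r, rfl⟩ := σ.surjective v
  obtain ⟨q, hq, hqR, hpq⟩ := exists_reachable_rlminPos hG hσ i p hu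
  obtain ⟨q', hq', hqR', hrq⟩ := exists_reachable_rlminPos hG hσ i r hv
  obtain rfl : q = q' :=
    le_antisymm (rlminPos_le_of_sameBlock hq' hq hqR') (rlminPos_le_of_sameBlock hq hq' hqR)
  exact hpq.trans hrq.symm
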